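/- Let u be an inner function on the open unit disk and a ∈ 𝔻. Define the Frostman shift u_a := (u − a)/(1 − ā·u), which is again inner. Then (1 − ā·u)^{-1}·K_u = K_{u_a}, i.e., the map f ↦ (1 − ā·u)^{-1} f carries the model space K_u onto the model space K_{u_a}. -/

import Mathlib

open Complex MeasureTheory Metric Filter Set Topology

noncomputable section

/-- The `n`-th Taylor coefficient of `f` at `0`. -/
def hcoeff (f : ℂ → ℂ) (n : ℕ) : ℂ := iteratedDeriv n f 0 / n.factorial

/-- Membership in the Hardy space `H²` of the open unit disk, described via
square-summability of the Taylor coefficients. -/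
def MemH2 (f : ℂ → ℂ) : Prop :=
  DifferentiableOn ℂ f (ball (0 : ℂ) 1) ∧ Summable fun n => ‖hcoeff f n‖ ^ 2

/-- The `H²` inner product, conjugate-linear in the first variable. -/
def hInner (f g : ℂ → ℂ) : ℂ := ∑' n : ℕ, (starRingEnd ℂ) (hcoeff f n) * hcoeff g n

/-- The squared `H²` norm. -/
def hNormSq (f : ℂ → ℂ) : ℝ := ∑' n : ℕ, ‖hcoeff f n‖ ^ 2

/-- Membership in `H^∞`: bounded analytic functions on the disk. -/
def MemHinf (f : ℂ → ℂ) : Prop :=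
  DifferentiableOn ℂ f (ball (0 : ℂ) 1) ∧ ∃ C : ℝ, ∀ z ∈ ball (0 : ℂ) 1, ‖f z‖ ≤ C

/-- An inner function: bounded analytic on the disk with unimodular radial
boundary values almost everywhere. -/
def IsInner (u : ℂ → ℂ) : Prop :=
  MemHinf u ∧
    ∀ᵐ θ : ℝ, ∃ L : ℂ, ‖L‖ = 1 ∧
      Tendsto (fun r : ℝ => u ((r : ℂ) * Complex.exp ((θ : ℂ) * Complex.I)))
        (𝓝[<] (1 : ℝ)) (𝓝 L)

/-- The model space `K_Θ = H² ⊖ Θ H²`: elements of `H²` orthogonal to `Θ H²`. -/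
def KSpace (Θ : ℂ → ℂ) : Set (ℂ → ℂ) :=
  {f | MemH2 f ∧ ∀ g : ℂ → ℂ, MemH2 g → hInner (fun z => Θ z * g z) f = 0}

/-- The multiplier space `𝓜(u, v) = {φ analytic on 𝔻 : φ · K_u ⊆ K_v}`. -/
def Mult (u v : ℂ → ℂ) : Set (ℂ → ℂ) :=
  {φ | DifferentiableOn ℂ φ (ball (0 : ℂ) 1) ∧
    ∀ f ∈ KSpace u, (fun z => φ z * f z) ∈ KSpace v}

/-- Radial boundary value of `f` at the point `e^{iθ}` of the unit circle. -/
def bdry (f : ℂ → ℂ) (θ : ℝ) : ℂ :=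
  limUnder (𝓝[<] (1 : ℝ)) fun r : ℝ => f ((r : ℂ) * Complex.exp ((θ : ℂ) * Complex.I))

/-- The kernel of the Toeplitz operator `T_{conj(z v) u}` on `H²`:
those `φ ∈ H²` with `P₊(conj(z v) u φ) = 0`, i.e. `conj(z v) u φ ⟂ H²`
in `L²` of the circle. -/
def kerToeplitzZVU (u v : ℂ → ℂ) : Set (ℂ → ℂ) :=
  {φ | MemH2 φ ∧ ∀ h : ℂ → ℂ, MemH2 h →
    (∫ θ in (0 : ℝ)..(2 * Real.pi),
      (starRingEnd ℂ) (Complex.exp ((θ : ℂ) * Complex.I) * bdry v θ) * bdry u θ * bdry φ θ *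
        (starRingEnd ℂ) (bdry h θ)) = 0}

/-- `|φ|² dm` is a Carleson measure for `K_u`. -/
def IsCarlesonForK (u φ : ℂ → ℂ) : Prop :=
  ∃ C : ℝ, ∀ f ∈ KSpace u,
    (∫ θ in (0 : ℝ)..(2 * Real.pi), ‖bdry f θ‖ ^ 2 * ‖bdry φ θ‖ ^ 2) ≤ C * hNormSq f

/-- The backward shift `(S^* f)(z) = (f(z) - f(0))/z`. -/
def bShift (f : ℂ → ℂ) : ℂ → ℂ := fun z =>
  if z = 0 then deriv f 0 else (f z - f 0) / z

/-- The reproducing kernel of the model space `K_Θ`. -/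
def repKer (Θ : ℂ → ℂ) (lam : ℂ) : ℂ → ℂ := fun z =>
  (1 - (starRingEnd ℂ) (Θ lam) * Θ z) / (1 - (starRingEnd ℂ) lam * z)

/-- A single Blaschke factor with zero at `a ∈ 𝔻`. -/
def blaschkeFactor (a : ℂ) : ℂ → ℂ := fun z =>
  if a = 0 then z else ((‖a‖ : ℂ) / a) * ((a - z) / (1 - (starRingEnd ℂ) a * z))

/-- A finite Blaschke product (on the disk). -/
def IsFiniteBlaschke (B : ℂ → ℂ) : Prop :=
  ∃ (c : ℂ) (N : ℕ) (a : Fin N → ℂ), ‖c‖ = 1 ∧ (∀ i, a i ∈ ball (0 : ℂ) 1) ∧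
    ∀ z ∈ ball (0 : ℂ) 1, B z = c * ∏ i, blaschkeFactor (a i) z

/-- The boundary spectrum `σ(u) = {ξ ∈ 𝕋 : liminf_{z → ξ, z ∈ 𝔻} |u(z)| = 0}`. -/
def bdrySpec (u : ℂ → ℂ) : Set ℂ :=
  {ξ | ‖ξ‖ = 1 ∧ Filter.liminf (fun z => ‖u z‖) (𝓝[ball (0 : ℂ) 1] ξ) = 0}

/-- An outer function:
`F(z) = c · exp(∫_𝕋 (ξ+z)/(ξ-z) log w(ξ) dm(ξ))` for a unimodular constant `c`
and a nonnegative weight `w` with `log w ∈ L¹`. -/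
def IsOuter (F : ℂ → ℂ) : Prop :=
  ∃ (c : ℂ) (w : ℝ → ℝ), ‖c‖ = 1 ∧ (∀ θ, 0 ≤ w θ) ∧
    IntervalIntegrable (fun θ => |Real.log (w θ)|) volume 0 (2 * Real.pi) ∧
    ∀ z ∈ ball (0 : ℂ) 1,
      F z = c * Complex.exp ((2 * (Real.pi : ℂ))⁻¹ *
        ∫ θ in (0 : ℝ)..(2 * Real.pi),
          ((Complex.exp ((θ : ℂ) * Complex.I) + z) /
              (Complex.exp ((θ : ℂ) * Complex.I) - z)) * (Real.log (w θ) : ℂ))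


/-! ### Taylor coefficients -/

lemma hcoeff_congr {f g : ℂ → ℂ} (h : ∀ z ∈ ball (0 : ℂ) 1, f z = g z) : hcoeff f = hcoeff g := by
  funext n
  have : f =ᶠ[𝓝 0] g := by
    filter_upwards [ball_mem_nhds (0 : ℂ) one_pos] with z hz using h z hz
  rw [hcoeff, hcoeff, this.iteratedDeriv_eq n]

lemma hasSum_hcoeff {f : ℂ → ℂ} (hf : DifferentiableOn ℂ f (ball (0 : ℂ) 1)) {z : ℂ}
    (hz : z ∈ ball (0 : ℂ) 1) : HasSum (fun n => hcoeff f n * z ^ n) (f z) := by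
  have h : (fun n => hcoeff f n * z ^ n)
      = fun n : ℕ => (n.factorial : ℂ)⁻¹ • (z - 0) ^ n • iteratedDeriv n f 0 := by
    funext n
    rw [hcoeff, sub_zero, smul_eq_mul, smul_eq_mul]
    ring
  rw [h]
  exact Complex.hasSum_taylorSeries_on_ball hf hz

lemma contDiffAt_zero_of_differentiableOn {f : ℂ → ℂ}
    (hf : DifferentiableOn ℂ f (ball (0 : ℂ) 1)) (n : ℕ) : ContDiffAt ℂ n f 0 :=
  (hf.analyticAt (ball_mem_nhds (0 : ℂ) one_pos)).contDiffAt

lemma hcoeff_add_const_mul {f g : ℂ → ℂ} (hf : DifferentiableOn ℂ f (ball (0 : ℂ) 1))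
    (hg : DifferentiableOn ℂ g (ball (0 : ℂ) 1)) (c : ℂ) (n : ℕ) :
    hcoeff (fun z => f z + c * g z) n = hcoeff f n + c * hcoeff g n := by
  have h1 := contDiffAt_zero_of_differentiableOn hf n
  have h2 := contDiffAt_zero_of_differentiableOn hg n
  have h3 : ContDiffAt ℂ n (fun z => c * g z) 0 := contDiffAt_const.mul h2
  have := iteratedDeriv_fun_add h1 h3
  simp only [hcoeff]
  rw [this, iteratedDeriv_const_mul_field]
  ring

lemma MemH2.congr {f g : ℂ → ℂ} (hf : MemH2 f) (h : ∀ z ∈ ball (0 : ℂ) 1, f z = g z) :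
    MemH2 g :=
  ⟨hf.1.congr fun z hz => (h z hz).symm, hcoeff_congr h ▸ hf.2⟩

lemma hInner_congr {f f' g g' : ℂ → ℂ} (hf : ∀ z ∈ ball (0 : ℂ) 1, f z = f' z)
    (hg : ∀ z ∈ ball (0 : ℂ) 1, g z = g' z) : hInner f g = hInner f' g' := by
  rw [hInner, hInner, hcoeff_congr hf, hcoeff_congr hg]

lemma MemH2.add_const_mul {f g : ℂ → ℂ} (hf : MemH2 f) (hg : MemH2 g) (c : ℂ) :
    MemH2 fun z => f z + c * g z := by
  refine ⟨hf.1.add (hg.1.const_mul c), ?_⟩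
  refine Summable.of_nonneg_of_le (fun n => by positivity) (fun n => ?_)
    ((hf.2.mul_left 2).add (hg.2.mul_left (2 * ‖c‖ ^ 2)))
  rw [hcoeff_add_const_mul hf.1 hg.1]
  have h := norm_add_le (hcoeff f n) (c * hcoeff g n)
  rw [norm_mul] at h
  nlinarith [sq_nonneg (‖hcoeff f n‖ - ‖c‖ * ‖hcoeff g n‖), norm_nonneg (hcoeff f n + c * hcoeff g n),
    norm_nonneg (hcoeff f n), norm_nonneg (hcoeff g n), norm_nonneg c,
    mul_nonneg (norm_nonneg c) (norm_nonneg (hcoeff g n))]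

/-! ### The inner product -/

lemma summable_hInner {f g : ℂ → ℂ} (hf : MemH2 f) (hg : MemH2 g) :
    Summable fun n => (starRingEnd ℂ) (hcoeff f n) * hcoeff g n := by
  refine Summable.of_norm_bounded (hf.2.add hg.2) fun n => ?_
  rw [norm_mul, RCLike.norm_conj]
  nlinarith [sq_nonneg (‖hcoeff f n‖ - ‖hcoeff g n‖), sq_nonneg (‖hcoeff f n‖),
    sq_nonneg (‖hcoeff g n‖)]

lemma hInner_add_const_mul_left {f g h : ℂ → ℂ} (hf : MemH2 f) (hg : MemH2 g) (hh : MemH2 h)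
    (c : ℂ) : hInner (fun z => f z + c * g z) h
      = hInner f h + (starRingEnd ℂ) c * hInner g h := by
  simp only [hInner]
  rw [← tsum_mul_left, ← (summable_hInner hf hh).tsum_add ((summable_hInner hg hh).mul_left _)]
  refine tsum_congr fun n => ?_
  rw [hcoeff_add_const_mul hf.1 hg.1, map_add, map_mul]
  ring

lemma hInner_add_const_mul_right {f g h : ℂ → ℂ} (hf : MemH2 f) (hg : MemH2 g) (hh : MemH2 h)
    (c : ℂ) : hInner h (fun z => f z + c * g z) = hInner h f + c * hInner h g := by
  simp only [hInner]
  rw [← tsum_mul_left, ← (summable_hInner hh hf).tsum_add ((summable_hInner hh hg).mul_left _)]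
  refine tsum_congr fun n => ?_
  rw [hcoeff_add_const_mul hf.1 hg.1]
  ring

lemma hNormSq_add_const_mul {f g : ℂ → ℂ} (hf : MemH2 f) (hg : MemH2 g) (c : ℂ) :
    hNormSq (fun z => f z + c * g z)
      = hNormSq f + ‖c‖ ^ 2 * hNormSq g + 2 * (c * hInner f g).re := by
  have h1 := (hf.2.hasSum.add (hg.2.hasSum.mul_left (‖c‖ ^ 2))).add
    ((Complex.hasSum_re ((summable_hInner hf hg).hasSum.mul_left c)).mul_left 2)
  refine Eq.trans (tsum_congr fun n => ?_) h1.tsum_eq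
  rw [hcoeff_add_const_mul hf.1 hg.1]
  simp only [← Complex.normSq_eq_norm_sq, Complex.normSq_apply, Complex.add_re, Complex.add_im,
    Complex.mul_re, Complex.mul_im, Complex.conj_re, Complex.conj_im]
  ring

/-- Polarization: a multiplier preserving the `H²` norm preserves the inner product. -/
lemma hInner_mul_eq_of_hNormSq_mul_eq {u : ℂ → ℂ}
    (hmem : ∀ p, MemH2 p → MemH2 fun z => u z * p z)
    (hnorm : ∀ p, MemH2 p → hNormSq (fun z => u z * p z) = hNormSq p)
    {p q : ℂ → ℂ} (hp : MemH2 p) (hq : MemH2 q) :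
    hInner (fun z => u z * p z) (fun z => u z * q z) = hInner p q := by
  have key : ∀ c : ℂ, (c * hInner (fun z => u z * p z) (fun z => u z * q z)).re
      = (c * hInner p q).re := fun c => by
    have h1 := hNormSq_add_const_mul hp hq c
    have h2 := hNormSq_add_const_mul (hmem p hp) (hmem q hq) c
    have h3 := hnorm _ (hp.add_const_mul hq c)
    have h4 : (fun z => u z * (p z + c * q z)) = fun z => u z * p z + c * (u z * q z) := by
      funext z; ring
    rw [h4, h2, h1, hnorm p hp, hnorm q hq] at h3
    linarith
  apply Complex.ext
  · simpa using key 1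
  · simpa using key Complex.I

/-! ### Parseval's identity on circles -/

lemma integral_exp_mul_conj_exp (m n : ℕ) :
    ∫ θ in (0 : ℝ)..(2 * Real.pi), Complex.exp (θ * Complex.I) ^ m *
      (starRingEnd ℂ) (Complex.exp (θ * Complex.I) ^ n) = if m = n then 2 * Real.pi else 0 := by
  have h : ∀ θ : ℝ, Complex.exp (θ * Complex.I) ^ m *
      (starRingEnd ℂ) (Complex.exp (θ * Complex.I) ^ n)
        = Complex.exp ((((m : ℂ) - n) * Complex.I) * θ) := fun θ => by
    rw [map_pow, ← Complex.exp_conj, ← Complex.exp_nat_mul, ← Complex.exp_nat_mul,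
      ← Complex.exp_add]
    congr 1
    simp only [map_mul, Complex.conj_ofReal, Complex.conj_I]
    ring
  simp only [h]
  split_ifs with hmn
  · simp [hmn]
  · have hne : ((m : ℂ) - n) * Complex.I ≠ 0 :=
      mul_ne_zero (sub_ne_zero.2 (by exact_mod_cast hmn)) Complex.I_ne_zero
    rw [integral_exp_mul_complex hne]
    have : ((m : ℂ) - n) * Complex.I * ((2 * Real.pi : ℝ) : ℂ)
        = ((m - n : ℤ) : ℂ) * (2 * Real.pi * Complex.I) := by push_cast; ring
    rw [this, Complex.exp_int_mul_two_pi_mul_I]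
    simp

/-- Term-by-term integration of an absolutely convergent Fourier series against a continuous
function. -/
lemma hasSum_integral_mul {b : ℕ → ℂ} (hb : Summable fun n => ‖b n‖) {F G : ℝ → ℂ}
    (hF : ∀ θ : ℝ, HasSum (fun n => b n * Complex.exp (θ * Complex.I) ^ n) (F θ))
    (hG : Continuous G) :
    HasSum (fun n => b n * ∫ θ in (0 : ℝ)..(2 * Real.pi), Complex.exp (θ * Complex.I) ^ n * G θ)
      (∫ θ in (0 : ℝ)..(2 * Real.pi), F θ * G θ) := by
  have := intervalIntegral.hasSum_integral_of_dominated_convergence (μ := volume)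
    (a := 0) (b := 2 * Real.pi)
    (F := fun n (θ : ℝ) => b n * (Complex.exp (θ * Complex.I) ^ n * G θ))
    (f := fun θ => F θ * G θ) (fun n θ => ‖b n‖ * ‖G θ‖)
    (fun n => (by fun_prop : Continuous _).aestronglyMeasurable)
    (fun n => ae_of_all _ fun θ _ => by
      simp [norm_pow, Complex.norm_exp_ofReal_mul_I])
    (ae_of_all _ fun θ _ => hb.mul_right _)
    (by simp only [tsum_mul_right]; exact (by fun_prop : Continuous _).intervalIntegrable _ _)
    (ae_of_all _ fun θ _ => by simpa only [mul_assoc] using (hF θ).mul_right (G θ))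
  simpa only [intervalIntegral.integral_const_mul] using this

lemma continuous_of_hasSum_exp {b : ℕ → ℂ} (hb : Summable fun n => ‖b n‖) {F : ℝ → ℂ}
    (hF : ∀ θ : ℝ, HasSum (fun n => b n * Complex.exp (θ * Complex.I) ^ n) (F θ)) :
    Continuous F := by
  have : F = fun θ : ℝ => ∑' n, b n * Complex.exp (θ * Complex.I) ^ n :=
    funext fun θ => (hF θ).tsum_eq.symm
  rw [this]
  exact continuous_tsum (fun n => by fun_prop) hb fun n θ => by
    simp [norm_pow, Complex.norm_exp_ofReal_mul_I]

lemma integral_norm_sq_of_hasSum_exp {b : ℕ → ℂ} (hb : Summable fun n => ‖b n‖) {F : ℝ → ℂ}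
    (hF : ∀ θ : ℝ, HasSum (fun n => b n * Complex.exp (θ * Complex.I) ^ n) (F θ)) :
    ∫ θ in (0 : ℝ)..(2 * Real.pi), ‖F θ‖ ^ 2 = 2 * Real.pi * ∑' n, ‖b n‖ ^ 2 := by
  have hFc := continuous_of_hasSum_exp hb hF
  have hcoef : ∀ n : ℕ, ∫ θ in (0 : ℝ)..(2 * Real.pi),
      Complex.exp (θ * Complex.I) ^ n * (starRingEnd ℂ) (F θ)
        = 2 * Real.pi * (starRingEnd ℂ) (b n) := fun n => by
    have h := hasSum_integral_mul hb hF
      (G := fun θ => (starRingEnd ℂ) (Complex.exp (θ * Complex.I) ^ n)) (by fun_prop)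
    simp only [integral_exp_mul_conj_exp] at h
    have h' := h.unique (hasSum_single n fun m hm => by simp [hm])
    have hconj : ∫ θ in (0 : ℝ)..(2 * Real.pi),
        Complex.exp (θ * Complex.I) ^ n * (starRingEnd ℂ) (F θ)
          = (starRingEnd ℂ) (∫ θ in (0 : ℝ)..(2 * Real.pi),
              F θ * (starRingEnd ℂ) (Complex.exp (θ * Complex.I) ^ n)) := by
      rw [← intervalIntegral.intervalIntegral_conj]
      simp [mul_comm]
    rw [hconj, h']
    simp [mul_comm, map_ofNat]
  have h := hasSum_integral_mul hb hF (G := fun θ => (starRingEnd ℂ) (F θ)) (by fun_prop)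
  simp only [hcoef, Complex.mul_conj'] at h
  have h2 : ∀ n, b n * (2 * Real.pi * (starRingEnd ℂ) (b n))
      = ((2 * Real.pi * ‖b n‖ ^ 2 : ℝ) : ℂ) := fun n => by
    rw [mul_left_comm, Complex.mul_conj']; push_cast; ring
  have h3 : ∫ θ in (0 : ℝ)..(2 * Real.pi), ((‖F θ‖ : ℂ)) ^ 2
      = ((∫ θ in (0 : ℝ)..(2 * Real.pi), ‖F θ‖ ^ 2 : ℝ) : ℂ) := by
    rw [← intervalIntegral.integral_ofReal]; push_cast; rfl
  simp only [h2, h3, Complex.hasSum_ofReal] at h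
  rw [← h.tsum_eq, tsum_mul_left]

/-! ### Integral means over circles -/

lemma ofReal_mul_exp_mem_ball {r : ℝ} (h0 : 0 ≤ r) (h1 : r < 1) (θ : ℝ) :
    (r : ℂ) * Complex.exp (θ * Complex.I) ∈ ball (0 : ℂ) 1 := by
  simpa [Complex.norm_exp_ofReal_mul_I, abs_of_nonneg h0] using h1

lemma continuous_comp_circle {f : ℂ → ℂ} (hf : DifferentiableOn ℂ f (ball (0 : ℂ) 1)) {r : ℝ}
    (h0 : 0 ≤ r) (h1 : r < 1) :
    Continuous fun θ : ℝ => f (r * Complex.exp (θ * Complex.I)) :=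
  hf.continuousOn.comp_continuous (by fun_prop) (ofReal_mul_exp_mem_ball h0 h1)

lemma summable_norm_hcoeff_mul_pow {f : ℂ → ℂ} (hf : DifferentiableOn ℂ f (ball (0 : ℂ) 1))
    {r : ℝ} (h0 : 0 ≤ r) (h1 : r < 1) : Summable fun n => ‖hcoeff f n * (r : ℂ) ^ n‖ :=
  (hasSum_hcoeff hf (z := r) (by simpa [abs_of_nonneg h0] using h1)).summable.norm

lemma hasSum_hcoeff_circle {f : ℂ → ℂ} (hf : DifferentiableOn ℂ f (ball (0 : ℂ) 1)) {r : ℝ}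
    (h0 : 0 ≤ r) (h1 : r < 1) (θ : ℝ) :
    HasSum (fun n => hcoeff f n * (r : ℂ) ^ n * Complex.exp (θ * Complex.I) ^ n)
      (f (r * Complex.exp (θ * Complex.I))) := by
  simpa only [mul_pow, mul_assoc] using hasSum_hcoeff hf (ofReal_mul_exp_mem_ball h0 h1 θ)

lemma integral_norm_sq_circle {f : ℂ → ℂ} (hf : DifferentiableOn ℂ f (ball (0 : ℂ) 1)) {r : ℝ}
    (h0 : 0 ≤ r) (h1 : r < 1) :
    ∫ θ in (0 : ℝ)..(2 * Real.pi), ‖f (r * Complex.exp (θ * Complex.I))‖ ^ 2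
      = 2 * Real.pi * ∑' n, ‖hcoeff f n * (r : ℂ) ^ n‖ ^ 2 :=
  integral_norm_sq_of_hasSum_exp (summable_norm_hcoeff_mul_pow hf h0 h1)
    (hasSum_hcoeff_circle hf h0 h1)

lemma norm_hcoeff_mul_pow_sq_le (f : ℂ → ℂ) {r : ℝ} (h0 : 0 ≤ r) (h1 : r < 1) (n : ℕ) :
    ‖hcoeff f n * (r : ℂ) ^ n‖ ^ 2 ≤ ‖hcoeff f n‖ ^ 2 := by
  have : ‖hcoeff f n * (r : ℂ) ^ n‖ ≤ ‖hcoeff f n‖ := by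
    rw [norm_mul, norm_pow, Complex.norm_real, Real.norm_of_nonneg h0]
    exact mul_le_of_le_one_right (norm_nonneg _) (pow_le_one₀ h0 h1.le)
  gcongr

lemma eventually_mem_Ico_nhdsLT_one : ∀ᶠ r : ℝ in 𝓝[<] 1, 0 ≤ r ∧ r < 1 := by
  filter_upwards [Ico_mem_nhdsLT (zero_lt_one (α := ℝ))] with r hr using hr

lemma tendsto_norm_hcoeff_mul_pow_sq (f : ℂ → ℂ) (n : ℕ) :
    Tendsto (fun r : ℝ => ‖hcoeff f n * (r : ℂ) ^ n‖ ^ 2) (𝓝[<] 1) (𝓝 (‖hcoeff f n‖ ^ 2)) := by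
  have : Continuous fun r : ℝ => ‖hcoeff f n * (r : ℂ) ^ n‖ ^ 2 := by fun_prop
  simpa using (this.tendsto 1).mono_left nhdsWithin_le_nhds

lemma MemH2.tendsto_integral_norm_sq {f : ℂ → ℂ} (hf : MemH2 f) :
    Tendsto (fun r : ℝ => ∫ θ in (0 : ℝ)..(2 * Real.pi),
      ‖f (r * Complex.exp (θ * Complex.I))‖ ^ 2) (𝓝[<] 1) (𝓝 (2 * Real.pi * hNormSq f)) := by
  have h : Tendsto (fun r : ℝ => ∑' n, ‖hcoeff f n * (r : ℂ) ^ n‖ ^ 2) (𝓝[<] 1)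
      (𝓝 (hNormSq f)) := by
    refine tendsto_tsum_of_dominated_convergence hf.2 (tendsto_norm_hcoeff_mul_pow_sq f) ?_
    filter_upwards [eventually_mem_Ico_nhdsLT_one] with r hr n
    rw [Real.norm_of_nonneg (by positivity)]
    exact norm_hcoeff_mul_pow_sq_le f hr.1 hr.2 n
  refine (h.const_mul (2 * Real.pi)).congr' ?_
  filter_upwards [eventually_mem_Ico_nhdsLT_one] with r hr
  rw [integral_norm_sq_circle hf.1 hr.1 hr.2]

lemma sum_norm_hcoeff_mul_pow_sq_le {f : ℂ → ℂ} (hf : DifferentiableOn ℂ f (ball (0 : ℂ) 1))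
    {r : ℝ} (h0 : 0 ≤ r) (h1 : r < 1) (s : Finset ℕ) :
    2 * Real.pi * ∑ n ∈ s, ‖hcoeff f n * (r : ℂ) ^ n‖ ^ 2
      ≤ ∫ θ in (0 : ℝ)..(2 * Real.pi), ‖f (r * Complex.exp (θ * Complex.I))‖ ^ 2 := by
  rw [integral_norm_sq_circle hf h0 h1]
  have hs := summable_norm_hcoeff_mul_pow hf h0 h1
  have hs2 : Summable fun n => ‖hcoeff f n * (r : ℂ) ^ n‖ ^ 2 := by
    simpa only [sq] using hs.mul_norm hs |>.comp_injective
      (i := fun n : ℕ => (n, n)) (fun a b h => (Prod.ext_iff.1 h).1) |>.congr fun n => by simp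
  gcongr
  exact hs2.sum_le_tsum s fun n _ => by positivity

/-- A bound on the integral means of `f` over the circles of radius `r → 1` bounds every finite
section of the coefficient sequence. -/
lemma sum_norm_hcoeff_sq_le {f : ℂ → ℂ} (hf : DifferentiableOn ℂ f (ball (0 : ℂ) 1))
    {M : ℝ → ℝ} {L : ℝ} (hM : Tendsto M (𝓝[<] 1) (𝓝 (2 * Real.pi * L)))
    (hle : ∀ r : ℝ, 0 ≤ r → r < 1 →
      ∫ θ in (0 : ℝ)..(2 * Real.pi), ‖f (r * Complex.exp (θ * Complex.I))‖ ^ 2 ≤ M r)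
    (s : Finset ℕ) : ∑ n ∈ s, ‖hcoeff f n‖ ^ 2 ≤ L := by
  have h1 : Tendsto (fun r : ℝ => 2 * Real.pi * ∑ n ∈ s, ‖hcoeff f n * (r : ℂ) ^ n‖ ^ 2) (𝓝[<] 1)
      (𝓝 (2 * Real.pi * ∑ n ∈ s, ‖hcoeff f n‖ ^ 2)) :=
    (tendsto_finsetSum s fun n _ => tendsto_norm_hcoeff_mul_pow_sq f n).const_mul _
  have h2 := le_of_tendsto_of_tendsto h1 hM (by
    filter_upwards [eventually_mem_Ico_nhdsLT_one] with r hr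
    exact (sum_norm_hcoeff_mul_pow_sq_le hf hr.1 hr.2 s).trans (hle r hr.1 hr.2))
  exact le_of_mul_le_mul_left h2 Real.two_pi_pos

/-- Bounded analytic functions multiply `H²` into itself. -/
lemma MemHinf.mul_memH2 {φ p : ℂ → ℂ} (hφ : MemHinf φ) (hp : MemH2 p) :
    MemH2 fun z => φ z * p z := by
  obtain ⟨hd, C, hC⟩ := hφ
  have hdp : DifferentiableOn ℂ (fun z => φ z * p z) (ball (0 : ℂ) 1) := hd.mul hp.1
  refine ⟨hdp, summable_of_sum_le (c := C ^ 2 * hNormSq p) (fun n => by positivity) ?_⟩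
  refine sum_norm_hcoeff_sq_le hdp
    (M := fun r => C ^ 2 * ∫ θ in (0 : ℝ)..(2 * Real.pi),
      ‖p (r * Complex.exp (θ * Complex.I))‖ ^ 2) ?_ fun r h0 h1 => ?_
  · convert hp.tendsto_integral_norm_sq.const_mul (C ^ 2) using 2
    ring
  · rw [← intervalIntegral.integral_const_mul]
    have hc1 := continuous_comp_circle hdp h0 h1
    have hc2 := continuous_comp_circle hp.1 h0 h1
    refine intervalIntegral.integral_mono_on Real.two_pi_pos.le
      ((hc1.norm.pow 2).intervalIntegrable _ _)
      (((hc2.norm.pow 2).const_mul _).intervalIntegrable _ _) fun θ _ => ?_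
    rw [norm_mul, mul_pow]
    have := hC _ (ofReal_mul_exp_mem_ball h0 h1 θ)
    gcongr

/-! ### Inner functions -/

lemma IsInner.tendsto_integral_norm_pow {u : ℂ → ℂ} (hu : IsInner u) (k : ℕ) :
    Tendsto (fun r : ℝ => ∫ θ in (0 : ℝ)..(2 * Real.pi),
      ‖u (r * Complex.exp (θ * Complex.I))‖ ^ k) (𝓝[<] 1) (𝓝 (2 * Real.pi)) := by
  obtain ⟨⟨hd, C, hC⟩, hb⟩ := hu
  have h := intervalIntegral.tendsto_integral_filter_of_dominated_convergence (μ := volume)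
    (a := 0) (b := 2 * Real.pi) (l := 𝓝[<] (1 : ℝ))
    (F := fun (r : ℝ) (θ : ℝ) => ‖u (r * Complex.exp (θ * Complex.I))‖ ^ k) (f := fun _ => (1 : ℝ))
    (fun _ => C ^ k) ?_ ?_ (by simp) ?_
  · simpa using h
  · filter_upwards [eventually_mem_Ico_nhdsLT_one] with r hr
    exact ((continuous_comp_circle hd hr.1 hr.2).norm.pow k).aestronglyMeasurable
  · filter_upwards [eventually_mem_Ico_nhdsLT_one] with r hr
    refine ae_of_all _ fun θ _ => ?_
    rw [Real.norm_of_nonneg (by positivity)]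
    have := hC _ (ofReal_mul_exp_mem_ball hr.1 hr.2 θ)
    gcongr
  · filter_upwards [hb] with θ ⟨L, hL, ht⟩ _
    simpa [hL] using ht.norm.pow k

lemma IsInner.norm_le_one {u : ℂ → ℂ} (hu : IsInner u) {z : ℂ} (hz : z ∈ ball (0 : ℂ) 1) :
    ‖u z‖ ≤ 1 := by
  have hz1 : ‖z‖ < 1 := by simpa using hz
  have hpow : ∀ k : ℕ, ‖u z‖ ^ k ≤ (1 - ‖z‖)⁻¹ := fun k => by
    have hd : DifferentiableOn ℂ (fun w => u w ^ k) (ball (0 : ℂ) 1) := hu.1.1.pow k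
    have hc : ∀ n, ‖hcoeff (fun w => u w ^ k) n‖ ≤ 1 := fun n => by
      have h := sum_norm_hcoeff_sq_le hd (L := 1)
        (M := fun r => ∫ θ in (0 : ℝ)..(2 * Real.pi),
          ‖u (r * Complex.exp (θ * Complex.I))‖ ^ (k * 2))
        (by simpa using hu.tendsto_integral_norm_pow (k * 2))
        (fun r _ _ => by simp only [norm_pow, pow_mul]; exact le_rfl) {n}
      rw [Finset.sum_singleton] at h
      exact (sq_le_one_iff₀ (norm_nonneg _)).1 h
    rw [← norm_pow]
    refine (hasSum_hcoeff hd hz).norm_le_of_bounded (hasSum_geometric_of_lt_one (norm_nonneg z) hz1)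
      fun n => ?_
    rw [norm_mul, norm_pow]
    exact mul_le_of_le_one_left (by positivity) (hc n)
  by_contra! h
  obtain ⟨k, hk⟩ := pow_unbounded_of_one_lt (1 - ‖z‖)⁻¹ h
  exact absurd (hpow k) hk.not_ge

/-- Pointwise on the circle of radius `r`, a function is bounded by its `N`-th Taylor polynomial
and the remainder, whose integral mean is controlled uniformly in `r`. -/
lemma MemH2.exists_remainder {p : ℂ → ℂ} (hp : MemH2 p) (N : ℕ) {r : ℝ} (h0 : 0 ≤ r)
    (h1 : r < 1) : ∃ E : ℝ → ℂ, Continuous E ∧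
      (∀ θ : ℝ, ‖p (r * Complex.exp (θ * Complex.I))‖ ≤
        ∑ n ∈ Finset.range N, ‖hcoeff p n‖ + ‖E θ‖) ∧
      ∫ θ in (0 : ℝ)..(2 * Real.pi), ‖E θ‖ ^ 2
        ≤ 2 * Real.pi * ∑' n, ‖hcoeff p (n + N)‖ ^ 2 := by
  set b : ℕ → ℂ := fun n => hcoeff p (n + N) * (r : ℂ) ^ (n + N) with hb
  have hbs : Summable fun n => ‖b n‖ :=
    (summable_nat_add_iff N).2 (summable_norm_hcoeff_mul_pow hp.1 h0 h1)
  have hs : ∀ θ : ℝ, Summable fun n => b n * Complex.exp (θ * Complex.I) ^ n := fun θ =>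
    Summable.of_norm_bounded hbs fun n => by simp [norm_pow, Complex.norm_exp_ofReal_mul_I]
  refine ⟨fun θ => ∑' n, b n * Complex.exp (θ * Complex.I) ^ n,
    continuous_of_hasSum_exp hbs fun θ => (hs θ).hasSum, fun θ => ?_, ?_⟩
  · have h := hasSum_hcoeff_circle hp.1 h0 h1 θ
    have hE : ∑' n, hcoeff p (n + N) * (r : ℂ) ^ (n + N) * Complex.exp (θ * Complex.I) ^ (n + N)
        = Complex.exp (θ * Complex.I) ^ N * ∑' n, b n * Complex.exp (θ * Complex.I) ^ n := by
      rw [← tsum_mul_left]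
      exact tsum_congr fun n => by simp only [hb, pow_add]; ring
    rw [← h.tsum_eq, ← h.summable.sum_add_tsum_nat_add N, hE]
    refine (norm_add_le _ _).trans (add_le_add ((norm_sum_le _ _).trans ?_) ?_)
    · refine Finset.sum_le_sum fun n _ => ?_
      rw [norm_mul, norm_mul, norm_pow, norm_pow, Complex.norm_exp_ofReal_mul_I, one_pow, mul_one,
        Complex.norm_real, Real.norm_of_nonneg h0]
      exact mul_le_of_le_one_right (norm_nonneg _) (pow_le_one₀ h0 h1.le)
    · rw [norm_mul, norm_pow, Complex.norm_exp_ofReal_mul_I, one_pow, one_mul]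
  · rw [integral_norm_sq_of_hasSum_exp hbs fun θ => (hs θ).hasSum]
    have h3 : Summable fun n => ‖hcoeff p (n + N)‖ ^ 2 :=
      (summable_nat_add_iff (f := fun n => ‖hcoeff p n‖ ^ 2) N).2 hp.2
    have h4 : ∀ n, ‖b n‖ ^ 2 ≤ ‖hcoeff p (n + N)‖ ^ 2 := fun n =>
      norm_hcoeff_mul_pow_sq_le p h0 h1 (n + N)
    have := (Summable.of_nonneg_of_le (fun n => by positivity) h4 h3).tsum_le_tsum h4 h3
    gcongr

/-- Multiplication by an inner function is isometric on `H²`. -/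
lemma IsInner.hNormSq_mul {u p : ℂ → ℂ} (hu : IsInner u) (hp : MemH2 p) :
    hNormSq (fun z => u z * p z) = hNormSq p := by
  have hup := hu.1.mul_memH2 hp
  set D : ℝ → ℝ := fun r => (∫ θ in (0 : ℝ)..(2 * Real.pi),
      ‖p (r * Complex.exp (θ * Complex.I))‖ ^ 2) - ∫ θ in (0 : ℝ)..(2 * Real.pi),
      ‖u (r * Complex.exp (θ * Complex.I)) * p (r * Complex.exp (θ * Complex.I))‖ ^ 2 with hD
  have hlim : Tendsto D (𝓝[<] 1)
      (𝓝 (2 * Real.pi * hNormSq p - 2 * Real.pi * hNormSq fun z => u z * p z)) :=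
    hp.tendsto_integral_norm_sq.sub hup.tendsto_integral_norm_sq
  have hD' : ∀ r : ℝ, 0 ≤ r → r < 1 → D r = ∫ θ in (0 : ℝ)..(2 * Real.pi),
      (1 - ‖u (r * Complex.exp (θ * Complex.I))‖ ^ 2) *
        ‖p (r * Complex.exp (θ * Complex.I))‖ ^ 2 := fun r h0 h1 => by
    have hcp := continuous_comp_circle hp.1 h0 h1
    have hcup := continuous_comp_circle hup.1 h0 h1
    refine (intervalIntegral.integral_sub ((hcp.norm.pow 2).intervalIntegrable _ _)
      ((hcup.norm.pow 2).intervalIntegrable _ _)).symm.trans ?_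
    refine intervalIntegral.integral_congr fun θ _ => ?_
    simp only [Pi.pow_apply, norm_mul]
    ring
  have hu1 : ∀ r : ℝ, 0 ≤ r → r < 1 → ∀ θ : ℝ,
      ‖u (r * Complex.exp (θ * Complex.I))‖ ^ 2 ≤ 1 := fun r h0 h1 θ =>
    pow_le_one₀ (norm_nonneg _) (hu.norm_le_one (ofReal_mul_exp_mem_ball h0 h1 θ))
  have hlow : 0 ≤ 2 * Real.pi * hNormSq p - 2 * Real.pi * hNormSq fun z => u z * p z := by
    refine ge_of_tendsto hlim ?_
    filter_upwards [eventually_mem_Ico_nhdsLT_one] with r hr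
    rw [hD' r hr.1 hr.2]
    exact intervalIntegral.integral_nonneg Real.two_pi_pos.le fun θ _ =>
      mul_nonneg (sub_nonneg.2 (hu1 r hr.1 hr.2 θ)) (by positivity)
  have hup_le : ∀ N : ℕ, 2 * Real.pi * hNormSq p - 2 * Real.pi * hNormSq (fun z => u z * p z)
      ≤ 2 * (2 * Real.pi * ∑' n, ‖hcoeff p (n + N)‖ ^ 2) := fun N => by
    set B := ∑ n ∈ Finset.range N, ‖hcoeff p n‖
    have hm : Tendsto (fun r : ℝ => 2 * B ^ 2 * (2 * Real.pi - ∫ θ in (0 : ℝ)..(2 * Real.pi),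
        ‖u (r * Complex.exp (θ * Complex.I))‖ ^ 2)
          + 2 * (2 * Real.pi * ∑' n, ‖hcoeff p (n + N)‖ ^ 2)) (𝓝[<] 1)
        (𝓝 (2 * (2 * Real.pi * ∑' n, ‖hcoeff p (n + N)‖ ^ 2))) := by
      simpa using (((hu.tendsto_integral_norm_pow 2).const_sub (2 * Real.pi)).const_mul
        (2 * B ^ 2)).add_const (2 * (2 * Real.pi * ∑' n, ‖hcoeff p (n + N)‖ ^ 2))
    refine le_of_tendsto_of_tendsto hlim hm ?_
    filter_upwards [eventually_mem_Ico_nhdsLT_one] with r hr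
    obtain ⟨E, hEc, hpE, hEi⟩ := hp.exists_remainder N hr.1 hr.2
    have hcp := continuous_comp_circle hp.1 hr.1 hr.2
    have hcu : Continuous fun θ : ℝ => 1 - ‖u (r * Complex.exp (θ * Complex.I))‖ ^ 2 :=
      continuous_const.sub ((continuous_comp_circle hu.1.1 hr.1 hr.2).norm.pow 2)
    have hcE : Continuous fun θ : ℝ => 2 * ‖E θ‖ ^ 2 := by fun_prop
    have hI1 : ∫ θ in (0 : ℝ)..(2 * Real.pi), (2 * B ^ 2 *
        (1 - ‖u (r * Complex.exp (θ * Complex.I))‖ ^ 2) + 2 * ‖E θ‖ ^ 2)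
        = 2 * B ^ 2 * (2 * Real.pi - ∫ θ in (0 : ℝ)..(2 * Real.pi),
          ‖u (r * Complex.exp (θ * Complex.I))‖ ^ 2)
          + 2 * ∫ θ in (0 : ℝ)..(2 * Real.pi), ‖E θ‖ ^ 2 := by
      have hsub := intervalIntegral.integral_sub (μ := volume) (a := 0) (b := 2 * Real.pi)
        (continuous_const (y := (1 : ℝ)) |>.intervalIntegrable _ _)
        (((continuous_comp_circle hu.1.1 hr.1 hr.2).norm.pow 2).intervalIntegrable _ _)
      rw [intervalIntegral.integral_add ((hcu.const_mul _).intervalIntegrable _ _)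
        (hcE.intervalIntegrable _ _),
        intervalIntegral.integral_const_mul, intervalIntegral.integral_const_mul]
      simp only [Pi.pow_apply] at hsub
      rw [hsub]
      simp
    calc D r ≤ ∫ θ in (0 : ℝ)..(2 * Real.pi), (2 * B ^ 2 *
        (1 - ‖u (r * Complex.exp (θ * Complex.I))‖ ^ 2) + 2 * ‖E θ‖ ^ 2) := by
          rw [hD' r hr.1 hr.2]
          refine intervalIntegral.integral_mono_on Real.two_pi_pos.le
            ((hcu.mul (hcp.norm.pow 2)).intervalIntegrable _ _)
            (((hcu.const_mul _).add hcE).intervalIntegrable _ _) fun θ _ => ?_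
          have h1 := hu1 r hr.1 hr.2 θ
          have h2 := sq_nonneg ‖u (r * Complex.exp (θ * Complex.I))‖
          have h3 : ‖p (r * Complex.exp (θ * Complex.I))‖ ^ 2 ≤ 2 * B ^ 2 + 2 * ‖E θ‖ ^ 2 :=
            (pow_le_pow_left₀ (norm_nonneg _) (hpE θ) 2).trans
              (by nlinarith [sq_nonneg (B - ‖E θ‖)])
          nlinarith [mul_le_mul_of_nonneg_left h3 (sub_nonneg.2 h1),
            mul_nonneg h2 (sq_nonneg ‖E θ‖)]
      _ ≤ _ := by
          rw [hI1]
          gcongr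
  have htail : Tendsto (fun N => 2 * (2 * Real.pi * ∑' n, ‖hcoeff p (n + N)‖ ^ 2)) atTop
      (𝓝 0) := by
    simpa using ((tendsto_sum_nat_add fun n => ‖hcoeff p n‖ ^ 2).const_mul
      (2 * Real.pi)).const_mul 2
  have hhigh := ge_of_tendsto' htail hup_le
  have := Real.two_pi_pos
  have heq : 2 * Real.pi * hNormSq (fun z => u z * p z) = 2 * Real.pi * hNormSq p := by linarith
  exact mul_left_cancel₀ this.ne' heq

lemma IsInner.hInner_mul_mul {u p q : ℂ → ℂ} (hu : IsInner u) (hp : MemH2 p) (hq : MemH2 q) :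
    hInner (fun z => u z * p z) (fun z => u z * q z) = hInner p q :=
  hInner_mul_eq_of_hNormSq_mul_eq (fun _ h => hu.1.mul_memH2 h) (fun _ h => hu.hNormSq_mul h)
    hp hq

/-! ### Frostman shifts -/

lemma one_sub_norm_le_norm_one_sub_conj_mul (a : ℂ) {w : ℂ} (hw : ‖w‖ ≤ 1) :
    1 - ‖a‖ ≤ ‖1 - (starRingEnd ℂ) a * w‖ := by
  have h := norm_sub_norm_le (1 : ℂ) ((starRingEnd ℂ) a * w)
  rw [norm_one, norm_mul, RCLike.norm_conj] at h
  have : ‖a‖ * ‖w‖ ≤ ‖a‖ := mul_le_of_le_one_right (norm_nonneg a) hw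
  linarith

lemma one_sub_conj_mul_ne_zero {a w : ℂ} (ha : ‖a‖ < 1) (hw : ‖w‖ ≤ 1) :
    1 - (starRingEnd ℂ) a * w ≠ 0 :=
  norm_pos_iff.1 ((sub_pos.2 ha).trans_le (one_sub_norm_le_norm_one_sub_conj_mul a hw))

lemma norm_sub_eq_norm_one_sub_conj_mul (a : ℂ) {w : ℂ} (hw : ‖w‖ = 1) :
    ‖w - a‖ = ‖1 - (starRingEnd ℂ) a * w‖ := by
  have h : w - a = w * (starRingEnd ℂ) (1 - (starRingEnd ℂ) a * w) := by
    have : w * (starRingEnd ℂ) w = 1 := by rw [Complex.mul_conj', hw]; simp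
    simp only [map_sub, map_one, map_mul, Complex.conj_conj]
    linear_combination -a * (-this)
  rw [h, norm_mul, hw, one_mul, RCLike.norm_conj]

lemma IsInner.memHinf_inv_one_sub {u : ℂ → ℂ} (hu : IsInner u) {a : ℂ} (ha : ‖a‖ < 1) :
    MemHinf fun z => (1 - (starRingEnd ℂ) a * u z)⁻¹ := by
  refine ⟨((differentiableOn_const 1).sub (hu.1.1.const_mul _)).inv fun z hz =>
    one_sub_conj_mul_ne_zero ha (hu.norm_le_one hz), (1 - ‖a‖)⁻¹, fun z hz => ?_⟩
  rw [norm_inv]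
  exact inv_anti₀ (sub_pos.2 ha) (one_sub_norm_le_norm_one_sub_conj_mul a (hu.norm_le_one hz))

lemma IsInner.frostman {u : ℂ → ℂ} (hu : IsInner u) {a : ℂ} (ha : ‖a‖ < 1) :
    IsInner fun z => (u z - a) / (1 - (starRingEnd ℂ) a * u z) := by
  obtain ⟨hd, C, hC⟩ := hu.memHinf_inv_one_sub ha
  refine ⟨⟨?_, (1 + ‖a‖) * C, fun z hz => ?_⟩, ?_⟩
  · simp only [div_eq_mul_inv]
    exact (hu.1.1.sub_const a).mul hd
  · beta_reduce
    rw [div_eq_mul_inv, norm_mul]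
    have h1 := (norm_sub_le (u z) a).trans (add_le_add_left (hu.norm_le_one hz) _)
    exact mul_le_mul h1 (hC z hz) (norm_nonneg _) (by positivity)
  · filter_upwards [hu.2] with θ ⟨L, hL, ht⟩
    have hne := one_sub_conj_mul_ne_zero (w := L) ha hL.le
    refine ⟨(L - a) / (1 - (starRingEnd ℂ) a * L), ?_,
      (ht.sub_const a).div ((ht.const_mul _).const_sub 1) hne⟩
    rw [norm_div, norm_sub_eq_norm_one_sub_conj_mul a hL, div_self (norm_ne_zero_iff.2 hne)]

/-- `⟨u p, (1 - ā u) q⟩ = ⟨(u - a) p, q⟩`, since multiplication by `u` is isometric. -/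
lemma IsInner.hInner_mul_one_sub {u p q : ℂ → ℂ} (hu : IsInner u) (hp : MemH2 p) (hq : MemH2 q)
    (a : ℂ) : hInner (fun z => u z * p z) (fun z => (1 - (starRingEnd ℂ) a * u z) * q z)
      = hInner (fun z => (u z - a) * p z) q := by
  have hup := hu.1.mul_memH2 hp
  have huq := hu.1.mul_memH2 hq
  have h1 : (fun z => (1 - (starRingEnd ℂ) a * u z) * q z)
      = fun z => q z + -(starRingEnd ℂ) a * (u z * q z) := by funext z; ring
  have h2 : (fun z => (u z - a) * p z) = fun z => u z * p z + -a * p z := by funext z; ring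
  rw [h1, h2, hInner_add_const_mul_right hq huq hup, hInner_add_const_mul_left hup hp hq,
    hu.hInner_mul_mul hp hq, map_neg]

/-- For inner `u` and `a ∈ 𝔻`, the Frostman shift `u_a = (u - a)/(1 - ā u)`
is inner and `(1 - ā u)⁻¹ · K_u = K_{u_a}`. -/
theorem stmt_2 (u : ℂ → ℂ) (a : ℂ) (hu : IsInner u) (ha : a ∈ ball (0 : ℂ) 1) :
    IsInner (fun z => (u z - a) / (1 - (starRingEnd ℂ) a * u z)) ∧
    {g | ∃ f ∈ KSpace u, ∀ z ∈ ball (0 : ℂ) 1,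
        g z = (1 - (starRingEnd ℂ) a * u z)⁻¹ * f z} =
      KSpace (fun z => (u z - a) / (1 - (starRingEnd ℂ) a * u z)) := by
  have ha1 : ‖a‖ < 1 := by simpa using ha
  have hne : ∀ z ∈ ball (0 : ℂ) 1, 1 - (starRingEnd ℂ) a * u z ≠ 0 := fun z hz =>
    one_sub_conj_mul_ne_zero ha1 (hu.norm_le_one hz)
  have hinv := hu.memHinf_inv_one_sub ha1
  refine ⟨hu.frostman ha1, Subset.antisymm ?_ ?_⟩
  · rintro g ⟨f, ⟨hf, hort⟩, hg⟩
    have hgm : MemH2 g := (hinv.mul_memH2 hf).congr fun z hz => (hg z hz).symm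
    refine ⟨hgm, fun h hh => ?_⟩
    have hp := hinv.mul_memH2 hh
    rw [← hort _ hp, hInner_congr (fun z _ => rfl) (fun z hz => ?_ :
      ∀ z ∈ ball (0 : ℂ) 1, f z = (1 - (starRingEnd ℂ) a * u z) * g z),
      hu.hInner_mul_one_sub hp hgm]
    · refine hInner_congr (fun z _ => ?_) fun z _ => rfl
      ring
    · rw [hg z hz, mul_inv_cancel_left₀ (hne z hz)]
  · rintro g ⟨hg, hort⟩
    have hfm : MemH2 fun z => (1 - (starRingEnd ℂ) a * u z) * g z :=
      (hg.add_const_mul (hu.1.mul_memH2 hg) (-(starRingEnd ℂ) a)).congr fun z _ => by ring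
    refine ⟨_, ⟨hfm, fun h hh => ?_⟩, fun z hz => (inv_mul_cancel_left₀ (hne z hz) _).symm⟩
    have hh' : MemH2 fun z => (1 - (starRingEnd ℂ) a * u z) * h z :=
      (hh.add_const_mul (hu.1.mul_memH2 hh) (-(starRingEnd ℂ) a)).congr fun z _ => by ring
    rw [hu.hInner_mul_one_sub hh hg, ← hort _ hh']
    refine hInner_congr (fun z hz => ?_) fun z _ => rfl
    rw [← mul_assoc, div_mul_cancel₀ _ (hne z hz)]

end
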